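/- Let p > 1 and q ∈ [0,p]. Then for any measurable f : ℝ → ℝ, the function x ↦ ∫_ℝ f(x+z) (max(|z|,1))^{−q} dz satisfies ‖x ↦ ∫ f(x+z)(|z| ∨ 1)^{−q} dz‖_{∞,q} ≤ K_p ‖f‖_{∞,p}, where K_p = 2^{p+4} p/(p−1). -/

import Mathlib

open MeasureTheory

/-- Weighted supremum norm `‖f‖_{∞,p} = sup_x |f(x)| (|x| ∨ 1)^p`, with values in `[0,∞]`. -/
noncomputable def wnorm (f : ℝ → ℝ) (p : ℝ) : ENNReal :=
  ⨆ x : ℝ, ENNReal.ofReal (|f x| * (max |x| 1) ^ p)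

theorem aux_g (p : ℝ) (hp : 1 < p) :
    IntegrableOn (fun t : ℝ => (max t 1) ^ (-p)) (Set.Ioi 0) ∧
    ∫ t in Set.Ioi (0:ℝ), (max t 1) ^ (-p) = p / (p - 1) := by
  have hU : Set.Ioi (0:ℝ) = Set.Ioc 0 1 ∪ Set.Ioi 1 :=
    (Set.Ioc_union_Ioi_eq_Ioi zero_le_one).symm
  have h1 : Set.EqOn (fun t : ℝ => (max t 1) ^ (-p)) (fun _ => (1:ℝ)) (Set.Ioc 0 1) := by
    intro t ht
    simp [max_eq_right ht.2]
  have h2 : Set.EqOn (fun t : ℝ => (max t 1) ^ (-p)) (fun t => t ^ (-p)) (Set.Ioi 1) := by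
    intro t ht
    simp [max_eq_left (le_of_lt (Set.mem_Ioi.1 ht))]
  have i1 : IntegrableOn (fun t : ℝ => (max t 1) ^ (-p)) (Set.Ioc 0 1) := by
    rw [integrableOn_congr_fun h1 measurableSet_Ioc]
    simp
  have i2 : IntegrableOn (fun t : ℝ => (max t 1) ^ (-p)) (Set.Ioi 1) := by
    rw [integrableOn_congr_fun h2 measurableSet_Ioi]
    exact integrableOn_Ioi_rpow_of_lt (by linarith) one_pos
  constructor
  · rw [hU]; exact i1.union i2
  · rw [hU, setIntegral_union (Set.Ioc_disjoint_Ioi le_rfl) measurableSet_Ioi i1 i2,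
      setIntegral_congr_fun measurableSet_Ioc h1, setIntegral_congr_fun measurableSet_Ioi h2,
      integral_Ioi_rpow_of_lt (by linarith) one_pos]
    have : p - 1 ≠ 0 := by linarith
    have : -p + 1 ≠ 0 := by linarith
    simp
    field_simp
    ring

theorem aux_int (p : ℝ) (hp : 1 < p) :
    ∫ t : ℝ, (max |t| 1) ^ (-p) = 2 * (p / (p - 1)) := by
  rw [integral_comp_abs (f := fun t : ℝ => (max t 1) ^ (-p)), (aux_g p hp).2]

theorem aux_integrable (p : ℝ) (hp : 1 < p) :
    Integrable (fun t : ℝ => (max |t| 1) ^ (-p)) := by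
  by_contra h
  have h1 := aux_int p hp
  rw [integral_undef h] at h1
  have : 0 < p / (p - 1) := div_pos (by linarith) (by linarith)
  linarith

theorem aux_pt (p q : ℝ) (hp : 1 < p) (hq0 : 0 ≤ q) (hqp : q ≤ p) (a b c : ℝ)
    (ha : 1 ≤ a) (hb : 1 ≤ b) (hc : 1 ≤ c) (h : c ≤ a + b) :
    a ^ (-p) * b ^ (-q) * c ^ q ≤ 2 ^ p * (2 * a ^ (-p) + b ^ (-p)) := by
  have ha0 : 0 < a := by linarith
  have hb0 : 0 < b := by linarith
  have hA : 0 < a ^ (-p) := Real.rpow_pos_of_pos ha0 _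
  have hB : 0 < b ^ (-p) := Real.rpow_pos_of_pos hb0 _
  have hBq : 0 < b ^ (-q) := Real.rpow_pos_of_pos hb0 _
  have h2 : (2:ℝ) ^ q ≤ 2 ^ p := Real.rpow_le_rpow_of_exponent_le (by norm_num) hqp
  have h20 : (0:ℝ) < 2 ^ q := by positivity
  rcases le_total a b with hab | hab
  · have hc' : c ^ q ≤ 2 ^ q * b ^ q := by
      rw [← Real.mul_rpow (by norm_num) hb0.le]
      exact Real.rpow_le_rpow (by linarith) (by linarith) hq0
    have e : b ^ (-q) * b ^ q = 1 := by rw [← Real.rpow_add hb0]; simp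
    calc a ^ (-p) * b ^ (-q) * c ^ q ≤ a ^ (-p) * b ^ (-q) * (2 ^ q * b ^ q) := by gcongr
      _ = 2 ^ q * a ^ (-p) * (b ^ (-q) * b ^ q) := by ring
      _ = 2 ^ q * a ^ (-p) := by rw [e, mul_one]
      _ ≤ 2 ^ p * (2 * a ^ (-p) + b ^ (-p)) := by gcongr; linarith
  · have hc' : c ^ q ≤ 2 ^ q * a ^ q := by
      rw [← Real.mul_rpow (by norm_num) ha0.le]
      exact Real.rpow_le_rpow (by linarith) (by linarith) hq0
    have e : a ^ (-p) * a ^ q ≤ b ^ (-(p - q)) := by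
      rw [← Real.rpow_add ha0, show -p + q = -(p - q) by ring]
      exact Real.rpow_le_rpow_of_nonpos hb0 hab (by linarith)
    have e2 : b ^ (-(p - q)) * b ^ (-q) = b ^ (-p) := by
      rw [← Real.rpow_add hb0]; congr 1; ring
    calc a ^ (-p) * b ^ (-q) * c ^ q ≤ a ^ (-p) * b ^ (-q) * (2 ^ q * a ^ q) := by gcongr
      _ = 2 ^ q * ((a ^ (-p) * a ^ q) * b ^ (-q)) := by ring
      _ ≤ 2 ^ q * (b ^ (-(p - q)) * b ^ (-q)) := by gcongr
      _ = 2 ^ q * b ^ (-p) := by rw [e2]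
      _ ≤ 2 ^ p * (2 * a ^ (-p) + b ^ (-p)) := by gcongr; linarith

theorem stmt3 (f : ℝ → ℝ) (hf : Measurable f) (p q : ℝ)
    (hp : 1 < p) (hq0 : 0 ≤ q) (hqp : q ≤ p) :
    wnorm (fun x => ∫ z : ℝ, f (x + z) * (max |z| 1) ^ (-q)) q
      ≤ ENNReal.ofReal (2 ^ (p + 4) * p / (p - 1)) * wnorm f p := by
  have hp1 : 0 < p - 1 := by linarith
  have hp0 : 0 < p := by linarith
  have hK : 0 < 2 ^ (p + 4) * p / (p - 1) := by positivity
  by_cases hM : wnorm f p = ⊤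
  · rw [hM, ENNReal.mul_top (by simpa using hK)]
    exact le_top
  obtain ⟨M, hM0, hMe⟩ : ∃ M : ℝ, 0 ≤ M ∧ wnorm f p = ENNReal.ofReal M :=
    ⟨(wnorm f p).toReal, ENNReal.toReal_nonneg, (ENNReal.ofReal_toReal hM).symm⟩
  have hfb : ∀ y, |f y| ≤ M * (max |y| 1) ^ (-p) := by
    intro y
    have h1 : ENNReal.ofReal (|f y| * (max |y| 1) ^ p) ≤ ENNReal.ofReal M := by
      rw [← hMe]
      exact le_iSup (fun x : ℝ => ENNReal.ofReal (|f x| * (max |x| 1) ^ p)) y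
    rw [ENNReal.ofReal_le_ofReal_iff hM0] at h1
    have h0 : 0 < max |y| 1 := lt_of_lt_of_le one_pos (le_max_right _ _)
    rw [Real.rpow_neg h0.le, ← div_eq_mul_inv, le_div_iff₀ (Real.rpow_pos_of_pos h0 _)]
    exact h1
  rw [hMe, ← ENNReal.ofReal_mul hK.le]
  refine iSup_le fun x => ENNReal.ofReal_le_ofReal ?_
  have hc1 : 1 ≤ max |x| 1 := le_max_right _ _
  have hc0 : 0 < max |x| 1 := by linarith
  have hI := aux_integrable p hp
  have hI' : Integrable (fun z : ℝ => (max |x + z| 1) ^ (-p)) := hI.comp_add_left x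
  have hJ' : ∫ z : ℝ, (max |x + z| 1) ^ (-p) = 2 * (p / (p - 1)) := by
    rw [← aux_int p hp]
    exact integral_add_left_eq_self (fun t : ℝ => (max |t| 1) ^ (-p)) x
  have hC : 0 < (max |x| 1) ^ q := Real.rpow_pos_of_pos hc0 _
  have key : |(∫ z : ℝ, f (x + z) * (max |z| 1) ^ (-q)) * (max |x| 1) ^ q| ≤
      ∫ z : ℝ, M * (2 ^ p * (2 * (max |x + z| 1) ^ (-p) + (max |z| 1) ^ (-p))) := by
    rw [← integral_mul_const, ← Real.norm_eq_abs]
    refine norm_integral_le_of_norm_le ((((hI'.const_mul 2).add hI).const_mul _).const_mul _) ?_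
    refine Filter.Eventually.of_forall fun z => ?_
    have hb1 : 1 ≤ max |z| 1 := le_max_right _ _
    have hb0 : 0 < max |z| 1 := by linarith
    have hBq : 0 < (max |z| 1) ^ (-q) := Real.rpow_pos_of_pos hb0 _
    have htri : max |x| 1 ≤ max |x + z| 1 + max |z| 1 := by
      have h1 : |x| ≤ |x + z| + |z| := by
        have := abs_sub (x + z) z
        simpa using this
      have h2 := le_max_left |x + z| 1
      have h3 := le_max_left |z| 1
      have h4 := le_max_right |x + z| 1
      exact max_le (by linarith) (by linarith)
    have := aux_pt p q hp hq0 hqp (max |x + z| 1) (max |z| 1) (max |x| 1)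
      (le_max_right _ _) hb1 hc1 htri
    rw [Real.norm_eq_abs, abs_mul, abs_mul, abs_of_pos hBq, abs_of_pos hC]
    calc |f (x + z)| * (max |z| 1) ^ (-q) * (max |x| 1) ^ q
        ≤ (M * (max |x + z| 1) ^ (-p)) * (max |z| 1) ^ (-q) * (max |x| 1) ^ q := by
          gcongr; exact hfb _
      _ = M * ((max |x + z| 1) ^ (-p) * (max |z| 1) ^ (-q) * (max |x| 1) ^ q) := by ring
      _ ≤ _ := by gcongr
  rw [abs_mul, abs_of_pos hC] at key
  refine key.trans ?_
  rw [integral_const_mul, integral_const_mul, integral_add (hI'.const_mul 2) hI,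
    integral_const_mul, hJ', aux_int p hp, Real.rpow_add (by norm_num)]
  have h16 : (2:ℝ) ^ (4:ℝ) = 16 := by norm_num
  rw [h16]
  have hX : 0 ≤ M * (2 ^ p * (p / (p - 1))) := by positivity
  have e : 2 ^ p * 16 * p / (p - 1) * M = 16 * (M * (2 ^ p * (p / (p - 1)))) := by ring
  rw [e]
  nlinarith
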